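/- Let (Ω, X_n, ℙ_x) be a Markov chain on a nonempty finite set V and let ∅ ≠ V_1 ⊊ V. Then for any A ⊆ V and x ∈ V with ℙ_x(τ_A < ∞) = 1 and every finite path w on V, ℙ_x(𝔏(X|_{[0,τ_A]}) = w) = ℙ_x(𝔏 ∘ 𝔏_{V_1}(X|_{[0,τ_A]}) = w); that is, first performing the partial loop erasure associated with V_1 and then the full loop erasure yields the same distribution as the full loop erasure alone. -/

import Mathlib

open MeasureTheory

namespace LERW

variable {V : Type*} [DecidableEq V]

/-- The suffix of `l` strictly after the last occurrence of `a` in `l`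
(`l` itself if `a` does not occur in `l`). -/
def dropToLastOcc (a : V) (l : List V) : List V :=
  (l.reverse.takeWhile (fun z => z ≠ a)).reverse

lemma dropToLastOcc_length_le (a : V) (l : List V) :
    (dropToLastOcc a l).length ≤ l.length := by
  unfold dropToLastOcc
  calc ((l.reverse.takeWhile (fun z => z ≠ a)).reverse).length
      = (l.reverse.takeWhile (fun z => z ≠ a)).length := by simp
    _ ≤ l.reverse.length := (List.takeWhile_sublist _).length_le
    _ = l.length := by simp

/-- Partial loop erasure `𝔏_S` of a finite path, associated with a set `S` of vertices. -/
def PLE (S : Finset V) : List V → List V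
  | [] => []
  | a :: rest =>
    if a ∈ S then
      if a = (a :: rest).getLast (List.cons_ne_nil a rest) then [a]
      else a :: PLE S (dropToLastOcc a rest)
    else
      if rest = [] then [a]
      else a :: PLE S rest
termination_by l => l.length
decreasing_by
  · simpa using Nat.lt_succ_of_le (dropToLastOcc_length_le a rest)
  · simp

variable [Fintype V]

/-- The (full) loop erasure `𝔏 = 𝔏_V`. -/
def LE : List V → List V := PLE Finset.univ

/-- Iterated partial loop erasure `𝔏_{W m} ∘ ⋯ ∘ 𝔏_{W 2} ∘ 𝔏_{W 1}`. -/
def iterPLE (W : ℕ → Finset V) : ℕ → List V → List V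
  | 0, l => l
  | n + 1, l => PLE (W (n + 1)) (iterPLE W n l)

/-- The remaining suffix `w|_{[n_j , η]}` of the loop-erasing walk of `𝔏` the first time
its current value equals `b` (`[]` if this never happens). -/
def LEsuffixAt (b : V) : List V → List V
  | [] => []
  | a :: rest =>
    if a = b then a :: rest
    else if a = (a :: rest).getLast (List.cons_ne_nil a rest) then []
    else LEsuffixAt b (dropToLastOcc a rest)
termination_by l => l.length
decreasing_by
  simpa using Nat.lt_succ_of_le (dropToLastOcc_length_le a rest)

/-- Entry time `τ_A` into `A ⊆ V`, valued in `ℕ∞`. -/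
noncomputable def entryTime (A : Finset V) (ω : ℕ → V) : ℕ∞ :=
  sInf {m : ℕ∞ | ∃ n : ℕ, m = (n : ℕ∞) ∧ ω n ∈ A}

/-- Entry time `τ_A` as a natural number (junk value `0` when `A` is never visited). -/
noncomputable def entryTimeNat (A : Finset V) (ω : ℕ → V) : ℕ :=
  sInf {n : ℕ | ω n ∈ A}

/-- The random finite path `X|_{[0, τ_A]} = (X_0, X_1, …, X_{τ_A})`. -/
noncomputable def stoppedPath (A : Finset V) (ω : ℕ → V) : List V :=
  (List.range (entryTimeNat A ω + 1)).map ω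

/-- Iterated hitting times `τ̊_W^{(n)}` of `W`, valued in `ℕ∞` (with the convention
`τ̊_W^{(0)} = 0`). -/
noncomputable def iterHit (W : Finset V) (ω : ℕ → V) : ℕ → ℕ∞
  | 0 => 0
  | n + 1 => sInf {m : ℕ∞ | ∃ k : ℕ, m = (k : ℕ∞) ∧ iterHit W ω n < (k : ℕ∞) ∧ ω k ∈ W}

/-- The time `τ̊_W^{(n)} ∧ τ_A`, as a natural number. -/
noncomputable def traceTime (W A : Finset V) (ω : ℕ → V) (n : ℕ) : ℕ :=
  (iterHit W ω n ⊓ entryTime A ω).toNat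

variable [MeasurableSpace V]

/-- The trace process `X̃_n = X_{τ̊_W^{(n)} ∧ τ_A}` (so `X̃_0 = X_0`). -/
noncomputable def traceProc (W A : Finset V) (ω : ℕ → V) (n : ℕ) : V :=
  ω (traceTime W A ω n)

/-- The Green function `G_B(x, y) = 𝔼_x(#{0 ≤ n < τ_{V∖B} : X_n = y})`. -/
noncomputable def green (μ : V → Measure (ℕ → V)) (B : Finset V) (x y : V) : ℝ :=
  ∑' n : ℕ, (μ x {ω | ω n = y ∧ ∀ k ≤ n, ω k ∈ B}).toReal

section aux
open scoped ENNReal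
theorem aux_drop {U : Type*} [DecidableEq U] (a : U) (l1 l2 : List U) (h : a ∉ l2) :
    dropToLastOcc a (l1 ++ a :: l2) = l2 := by
  unfold dropToLastOcc
  have : ∀ z ∈ l2.reverse, decide (z ≠ a) = true := by
    intro z hz
    simp only [List.mem_reverse] at hz
    simp only [decide_eq_true_eq]
    rintro rfl; exact h hz
  simp only [List.reverse_append, List.reverse_cons, List.append_assoc]
  rw [List.takeWhile_append_of_pos this]
  simp

theorem aux_drop_not {U : Type*} [DecidableEq U] (a : U) (l : List U) (h : a ∉ l) :
    dropToLastOcc a l = l := by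
  unfold dropToLastOcc
  have : ∀ z ∈ l.reverse, decide (z ≠ a) = true := by
    intro z hz
    simp only [List.mem_reverse] at hz
    simp only [decide_eq_true_eq]
    rintro rfl; exact h hz
  rw [List.takeWhile_eq_self_iff.2 this]
  simp

theorem aux_exists_last {U : Type*} [DecidableEq U] (a : U) (l : List U) (h : a ∈ l) :
    ∃ l1 l2, a ∉ l2 ∧ l = l1 ++ a :: l2 := by
  induction l with
  | nil => simp at h
  | cons b l ih =>
    by_cases hl : a ∈ l
    · obtain ⟨l1, l2, h2, rfl⟩ := ih hl
      exact ⟨b :: l1, l2, h2, rfl⟩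
    · have : a = b := by simpa [hl] using h
      subst this
      exact ⟨[], l, hl, rfl⟩

theorem tsum_split_last {U : Type*} [DecidableEq U] (a : U) (f : List U → ℝ≥0∞) :
    ∑' l, f l = (∑' l, if a ∈ l then 0 else f l) +
      ∑' l2, ∑' l1, if a ∈ l2 then 0 else f (l1 ++ a :: l2) := by
  have h1 : ∀ l, f l = (if a ∈ l then 0 else f l) + (if a ∈ l then f l else 0) := by
    intro l; split_ifs <;> simp
  rw [tsum_congr h1, ENNReal.tsum_add]
  congr 1
  let g : {l2 : List U // a ∉ l2} × List U → List U := fun q => q.2 ++ a :: q.1.1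
  have hg : Function.Injective g := by
    rintro ⟨⟨l2, h2⟩, l1⟩ ⟨⟨m2, k2⟩, m1⟩ h
    simp only [g] at h
    have e : l2 = m2 := by rw [← aux_drop a l1 l2 h2, h, aux_drop a m1 m2 k2]
    subst e
    have e2 := List.append_cancel_right h
    subst e2
    rfl
  have hs : Function.support (fun l => if a ∈ l then f l else 0) ⊆ Set.range g := by
    intro l hl
    have ha : a ∈ l := by
      by_contra hn
      simp [hn] at hl
    obtain ⟨l1, l2, h2, rfl⟩ := aux_exists_last a l ha
    exact ⟨(⟨l2, h2⟩, l1), rfl⟩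
  rw [← hg.tsum_eq hs, ENNReal.tsum_prod']
  rw [← tsum_subtype_eq_of_support_subset (s := {l2 : List U | a ∉ l2})]
  · refine tsum_congr ?_
    rintro ⟨l2, h2⟩
    refine tsum_congr ?_
    intro l1
    have h2' : a ∉ l2 := h2
    simp [g, h2']
  · intro l hl
    by_contra hn
    have : a ∈ l := by simpa using hn
    simp [this] at hl

theorem tsum_rev {U : Type*} (f : List U → ℝ≥0∞) :
    ∑' l : List U, f l = ∑' l : List U, f l.reverse := by
  have := (Equiv.tsum_eq (⟨List.reverse, List.reverse, List.reverse_reverse,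
    List.reverse_reverse⟩ : List U ≃ List U) f)
  exact this.symm

theorem tsum_split_first {U : Type*} [DecidableEq U] (a : U) (f : List U → ℝ≥0∞) :
    ∑' l, f l = (∑' l, if a ∈ l then 0 else f l) +
      ∑' l1, ∑' l2, if a ∈ l1 then 0 else f (l1 ++ a :: l2) := by
  rw [tsum_rev, tsum_split_last a]
  congr 1
  · rw [tsum_rev (fun l => if a ∈ l then 0 else f l)]
    simp
  · rw [tsum_rev (fun l1 => ∑' l2, if a ∈ l1 then 0 else f (l1 ++ a :: l2))]
    refine tsum_congr ?_
    intro l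
    rw [tsum_rev (fun l2 => if a ∈ l.reverse then 0 else f (l.reverse ++ a :: l2))]
    simp

theorem tsum_list_cons {U : Type*} (f : List U → ℝ≥0∞) :
    ∑' l, f l = f [] + ∑' b, ∑' l, f (b :: l) := by
  have h1 : ∀ l, f l = (if l = [] then f [] else 0) + (if l = [] then 0 else f l) := by
    intro l; split_ifs with h <;> simp [h]
  rw [tsum_congr h1, ENNReal.tsum_add]
  congr 1
  · rw [tsum_eq_single []]
    · simp
    · intro l hl; simp [hl]
  let g : U × List U → List U := fun q => q.1 :: q.2
  have hg : Function.Injective g := by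
    rintro ⟨a, l⟩ ⟨b, m⟩ h
    simpa [g] using h
  have hs : Function.support (fun l => if l = [] then 0 else f l) ⊆ Set.range g := by
    intro l hl
    cases l with
    | nil => simp at hl
    | cons a l => exact ⟨(a, l), rfl⟩
  rw [← hg.tsum_eq hs, ENNReal.tsum_prod']
  simp [g]

theorem tsum_list_snoc {U : Type*} (f : List U → ℝ≥0∞) :
    ∑' l, f l = f [] + ∑' b, ∑' l, f (l ++ [b]) := by
  rw [tsum_rev, tsum_list_cons]
  congr 1
  refine tsum_congr fun b => ?_
  rw [tsum_rev (fun l => f (l ++ [b]))]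
  simp

/-- indicator -/
noncomputable def ind (q : Prop) : ℝ≥0∞ := by
  classical exact if q then 1 else 0

theorem ind_pos {q : Prop} (h : q) : ind q = 1 := by simp [ind, h]
theorem ind_neg {q : Prop} (h : ¬ q) : ind q = 0 := by simp [ind, h]
theorem ind_and (q r : Prop) : ind (q ∧ r) = ind q * ind r := by
  by_cases hq : q <;> by_cases hr : r <;> simp [ind, hq, hr]
theorem ind_mul_congr {q : Prop} {a b : ℝ≥0∞} (h : q → a = b) : ind q * a = ind q * b := by
  by_cases hq : q
  · rw [h hq]
  · simp [ind_neg hq]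
theorem ind_congr {q r : Prop} (h : q ↔ r) : ind q = ind r := by rw [propext h]

theorem tsum_last {U : Type*} (a : U) (f : List U → ℝ≥0∞) :
    ∑' l : List U, f l = (∑' l : List U, ind (a ∉ l) * f l) +
      ∑' l2 : List U, ∑' l1 : List U, ind (a ∉ l2) * f (l1 ++ a :: l2) := by
  classical
  rw [tsum_split_last a]
  congr 1
  · refine tsum_congr fun l => ?_
    by_cases h : a ∈ l <;> simp [h, ind]
  · refine tsum_congr fun l => tsum_congr fun l1 => ?_
    by_cases h : a ∈ l <;> simp [h, ind]

theorem tsum_first {U : Type*} (a : U) (f : List U → ℝ≥0∞) :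
    ∑' l : List U, f l = (∑' l : List U, ind (a ∉ l) * f l) +
      ∑' l1 : List U, ∑' l2 : List U, ind (a ∉ l1) * f (l1 ++ a :: l2) := by
  classical
  rw [tsum_split_first a]
  congr 1
  · refine tsum_congr fun l => ?_
    by_cases h : a ∈ l <;> simp [h, ind]
  · refine tsum_congr fun l => tsum_congr fun l1 => ?_
    by_cases h : a ∈ l <;> simp [h, ind]

/-- all vertices in `D` -/
def dom {U : Type*} (D : Finset U) (l : List U) : Prop := ∀ z ∈ l, z ∈ D

theorem dom_erase {U : Type*} [DecidableEq U] (D : Finset U) (c : U) (l : List U) :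
    (c ∉ l ∧ dom D l) ↔ dom (D.erase c) l := by
  simp only [dom, Finset.mem_erase]; grind

theorem dom_last {U : Type*} [DecidableEq U] (D : Finset U) (c : U) (hc : c ∈ D) (l m : List U) :
    (c ∉ m ∧ dom D (l ++ c :: m)) ↔ dom D l ∧ dom (D.erase c) m := by
  simp only [dom, Finset.mem_erase, List.mem_append, List.mem_cons]; grind

theorem dom_first {U : Type*} [DecidableEq U] (D : Finset U) (c : U) (hc : c ∈ D) (l m : List U) :
    (c ∉ l ∧ dom D (l ++ c :: m)) ↔ dom (D.erase c) l ∧ dom D m := by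
  simp only [dom, Finset.mem_erase, List.mem_append, List.mem_cons]; grind

/-- path weight with initial weights p -/
noncomputable def wt {U : Type*} (P : U → U → ℝ≥0∞) : (U → ℝ≥0∞) → List U → ℝ≥0∞
  | _, [] => 1
  | p, b :: l => p b * wt P (P b) l

theorem wt_append {U : Type*} (P : U → U → ℝ≥0∞) (p : U → ℝ≥0∞) (l m : List U) (a : U) :
    wt P p (l ++ a :: m) = wt P p (l ++ [a]) * wt P (P a) m := by
  induction l generalizing p with
  | nil => simp [wt]
  | cons b l ih => simp [wt, ih, mul_assoc]

/-- total weight of paths to `b` with interior in `D` -/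
noncomputable def NN {U : Type*} (P : U → U → ℝ≥0∞) (D : Finset U) (p : U → ℝ≥0∞) (b : U) : ℝ≥0∞ :=
  ∑' l : List U, ind (dom D l) * wt P p (l ++ [b])

theorem wt_append' {U : Type*} (P : U → U → ℝ≥0∞) (p : U → ℝ≥0∞) (l m : List U) (a b : U) :
    wt P p (l ++ a :: m ++ [b]) = wt P p (l ++ [a]) * wt P (P a) (m ++ [b]) := by
  rw [← wt_append]; simp

theorem NN_last {U : Type*} [DecidableEq U] (P : U → U → ℝ≥0∞) (D : Finset U) (p : U → ℝ≥0∞)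
    (b c : U) (hc : c ∈ D) :
    NN P D p b = NN P (D.erase c) p b + NN P D p c * NN P (D.erase c) (P c) b := by
  unfold NN
  rw [tsum_last c]
  congr 1
  · refine tsum_congr fun l => ?_
    rw [← mul_assoc, ← ind_and, ind_congr (dom_erase D c l)]
  · rw [← ENNReal.tsum_mul_left]
    refine tsum_congr fun l2 => ?_
    rw [← ENNReal.tsum_mul_right]
    refine tsum_congr fun l1 => ?_
    rw [wt_append', ← mul_assoc, ← ind_and, ind_congr (dom_last D c hc l1 l2), ind_and]
    ring

theorem NN_first {U : Type*} [DecidableEq U] (P : U → U → ℝ≥0∞) (D : Finset U) (p : U → ℝ≥0∞)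
    (b c : U) (hc : c ∈ D) :
    NN P D p b = NN P (D.erase c) p b + NN P (D.erase c) p c * NN P D (P c) b := by
  unfold NN
  rw [tsum_first c]
  congr 1
  · refine tsum_congr fun l => ?_
    rw [← mul_assoc, ← ind_and, ind_congr (dom_erase D c l)]
  · rw [← ENNReal.tsum_mul_right]
    refine tsum_congr fun l1 => ?_
    rw [← ENNReal.tsum_mul_left]
    refine tsum_congr fun l2 => ?_
    rw [wt_append', ← mul_assoc, ← ind_and, ind_congr (dom_first D c hc l1 l2), ind_and]
    ring

/-- Green function at `a` -/
noncomputable def GG {U : Type*} [DecidableEq U] (P : U → U → ℝ≥0∞) (D : Finset U) (a : U) : ℝ≥0∞ :=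
  1 + NN P D (P a) a

theorem GG_symm {U : Type*} [DecidableEq U] (P : U → U → ℝ≥0∞) (D : Finset U) (a b : U)
    (ha : a ∈ D) (hb : b ∈ D) (hab : a ≠ b) :
    GG P D a * GG P (D.erase a) b = GG P D b * GG P (D.erase b) a := by
  have h1 := NN_last P D (P a) a b hb
  have h2 := NN_first P (D.erase b) (P b) a a (Finset.mem_erase.2 ⟨hab, ha⟩)
  have h3 := NN_first P D (P b) b a ha
  have h4 := NN_last P (D.erase a) (P b) a b (Finset.mem_erase.2 ⟨hab.symm, hb⟩)
  rw [Finset.erase_right_comm] at h4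
  unfold GG
  rw [h1, h3, h2, h4]
  ring

/-- product of Green functions along a list -/
noncomputable def FF {U : Type*} [DecidableEq U] (P : U → U → ℝ≥0∞) : Finset U → List U → ℝ≥0∞
  | _, [] => 1
  | D, b :: l => GG P D b * FF P (D.erase b) l

theorem FF_perm {U : Type*} [DecidableEq U] (P : U → U → ℝ≥0∞) {l m : List U} (h : l.Perm m) :
    ∀ D : Finset U, l.Nodup → (∀ z ∈ l, z ∈ D) → FF P D l = FF P D m := by
  induction h with
  | nil => intros; rfl
  | cons a h ih =>
    intro D hn hs
    simp only [FF]
    rw [ih]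
    · exact (List.nodup_cons.1 hn).2
    · intro z hz
      refine Finset.mem_erase.2 ⟨?_, hs z (by simp [hz])⟩
      rintro rfl
      exact (List.nodup_cons.1 hn).1 hz
  | swap a b l =>
    intro D hn hs
    simp only [FF]
    rw [← mul_assoc, ← mul_assoc, GG_symm P D b a (hs _ (by simp)) (hs _ (by simp)) (by
      rintro rfl; simp at hn), Finset.erase_right_comm]
  | trans h1 h2 ih1 ih2 =>
    intro D hn hs
    rw [ih1 D hn hs, ih2 D (h1.nodup hn) (fun z hz => hs z (h1.mem_iff.2 hz))]

theorem FF_append {U : Type*} [DecidableEq U] (P : U → U → ℝ≥0∞) (l m : List U) (D : Finset U) :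
    FF P D (l ++ m) = FF P D l * FF P (D \ l.toFinset) m := by
  induction l generalizing D with
  | nil => simp [FF]
  | cons b l ih =>
    simp only [List.cons_append, FF, ih, mul_assoc]
    congr 3
    ext z; simp; grind

/-- partial erasure of the interior -/
def ple {U : Type*} [DecidableEq U] (S : Finset U) : List U → List U
  | [] => []
  | a :: rest =>
    if a ∈ S then a :: ple S (dropToLastOcc a rest)
    else a :: ple S rest
termination_by l => l.length
decreasing_by
  · simpa using Nat.lt_succ_of_le (dropToLastOcc_length_le a rest)
  · simp

theorem drop_mem {U : Type*} [DecidableEq U] (a : U) (l : List U) {z : U}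
    (h : z ∈ dropToLastOcc a l) : z ∈ l := by
  unfold dropToLastOcc at h
  have := (List.takeWhile_sublist _).subset (List.mem_reverse.1 h)
  simpa using this

theorem ple_mem {U : Type*} [DecidableEq U] (S : Finset U) (l : List U) {z : U}
    (h : z ∈ ple S l) : z ∈ l := by
  induction hn : l.length using Nat.strong_induction_on generalizing l with
  | _ n ih =>
    subst hn
    cases l with
    | nil => simp [ple] at h
    | cons a l =>
      rw [ple] at h
      split_ifs at h
      · rcases List.mem_cons.1 h with h | h
        · simp [h]
        · have := ih _ (Nat.lt_succ_of_le (dropToLastOcc_length_le a l)) _ h rfl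
          exact List.mem_cons_of_mem _ (drop_mem a l this)
      · rcases List.mem_cons.1 h with h | h
        · simp [h]
        · exact List.mem_cons_of_mem _ (ih _ (by simp) _ h rfl)

theorem drop_snoc {U : Type*} [DecidableEq U] (a y : U) (l : List U) (h : a ≠ y) :
    dropToLastOcc a (l ++ [y]) = dropToLastOcc a l ++ [y] := by
  unfold dropToLastOcc
  simp [h.symm]

theorem PLE_snoc {U : Type*} [DecidableEq U] (S : Finset U) (y : U) (l : List U) (h : y ∉ l) :
    PLE S (l ++ [y]) = ple S l ++ [y] := by
  induction hn : l.length using Nat.strong_induction_on generalizing l with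
  | _ n ih =>
    subst hn
    cases l with
    | nil => simp [PLE, ple]
    | cons a l =>
      have hay : a ≠ y := by rintro rfl; simp at h
      have hl : y ∉ l := fun h' => h (by simp [h'])
      rw [List.cons_append, PLE, ple]
      split_ifs with h1 h2 h3
      · exfalso; apply hay; rw [h2]; simp
      · rw [drop_snoc a y l hay, ih _ (Nat.lt_succ_of_le (dropToLastOcc_length_le a l)) _
          (fun h' => hl (drop_mem a l h')) rfl]
        simp
      · simp at h3
      · rw [ih _ (by simp) _ hl rfl]; simp

theorem tsum_peel {U : Type*} (b : U) (f : List U → ℝ≥0∞) (h0 : f [] = 0)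
    (h : ∀ a l, a ≠ b → f (a :: l) = 0) : ∑' l, f l = ∑' l, f (b :: l) := by
  rw [tsum_list_cons, h0, zero_add, tsum_eq_single b]
  intro a ha
  simp [h a _ ha]

theorem loop_factor {U : Type*} [DecidableEq U] (P : U → U → ℝ≥0∞) (D : Finset U) (b y : U)
    (hb : b ∈ D) (h : List U → ℝ≥0∞) :
    ∑' l : List U, ind (dom D l) * wt P (P b) (l ++ [y]) * h (dropToLastOcc b l) =
      GG P D b * ∑' l : List U, ind (dom (D.erase b) l) * wt P (P b) (l ++ [y]) * h l := by
  rw [tsum_last b, GG, add_mul, one_mul]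
  congr 1
  · refine tsum_congr fun l => ?_
    rw [← ind_congr (dom_erase D b l), ind_and]
    simp only [mul_assoc]
    refine ind_mul_congr fun hl => ?_
    rw [aux_drop_not b l hl]
  · rw [NN, ← ENNReal.tsum_mul_left]
    refine tsum_congr fun l2 => ?_
    rw [← ENNReal.tsum_mul_right]
    refine tsum_congr fun l1 => ?_
    have e : ind (dom D l1) * wt P (P b) (l1 ++ [b]) *
        (ind (dom (D.erase b) l2) * wt P (P b) (l2 ++ [y]) * h l2) =
        ind (b ∉ l2) * (ind (dom D (l1 ++ b :: l2)) * wt P (P b) (l1 ++ [b]) *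
          wt P (P b) (l2 ++ [y]) * h l2) := by
      have := ind_congr (dom_last D b hb l1 l2)
      rw [ind_and, ind_and] at this
      calc _ = (ind (dom D l1) * ind (dom (D.erase b) l2)) * (wt P (P b) (l1 ++ [b]) *
          wt P (P b) (l2 ++ [y]) * h l2) := by ring
        _ = _ := by rw [← this]; ring
    rw [e]
    refine ind_mul_congr fun hl => ?_
    rw [aux_drop b l1 l2 hl, wt_append']
    ring

theorem ple_cons_ne {U : Type*} [DecidableEq U] (S : Finset U) (a b : U) (l m : List U) (h : a ≠ b) :
    ple S (a :: l) ≠ b :: m := by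
  rw [ple]
  split_ifs <;> simp [h]

theorem ple_nil_iff {U : Type*} [DecidableEq U] (S : Finset U) (l : List U) :
    ple S l = [] ↔ l = [] := by
  cases l with
  | nil => simp [ple]
  | cons a l => rw [ple]; split_ifs <;> simp

/-- the `S`-part of a list -/
def fil {U : Type*} [DecidableEq U] (S : Finset U) (l : List U) : List U := l.filter (fun z => z ∈ S)

theorem mem_fil {U : Type*} [DecidableEq U] (S : Finset U) (l : List U) (z : U) :
    z ∈ fil S l ↔ z ∈ l ∧ z ∈ S := by simp [fil]

theorem fil_cons_mem {U : Type*} [DecidableEq U] {S : Finset U} (l : List U) {b : U} (h : b ∈ S) :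
    fil S (b :: l) = b :: fil S l := by simp [fil, h]
theorem fil_cons_not {U : Type*} [DecidableEq U] {S : Finset U} (l : List U) {b : U} (h : b ∉ S) :
    fil S (b :: l) = fil S l := by simp [fil, h]
theorem fil_append {U : Type*} [DecidableEq U] (S : Finset U) (l m : List U) :
    fil S (l ++ m) = fil S l ++ fil S m := by simp [fil]

theorem dom_cons {U : Type*} (D : Finset U) (b : U) (l : List U) :
    dom D (b :: l) ↔ b ∈ D ∧ dom D l := by simp [dom]

theorem tsum_nil_only {U : Type*} (f : List U → ℝ≥0∞) (h : ∀ l, l ≠ [] → f l = 0) :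
    ∑' l, f l = f [] := tsum_eq_single [] h

theorem ple_mass {U : Type*} [DecidableEq U] (P : U → U → ℝ≥0∞) (S : Finset U) (y : U) (m : List U) :
    ∀ (D : Finset U) (p : U → ℝ≥0∞),
    ∑' l : List U, ind (dom D l) * wt P p (l ++ [y]) * ind (ple S l = m) =
      ind (dom D m) * ind (fil S m).Nodup * wt P p (m ++ [y]) * FF P D (fil S m) := by
  induction m with
  | nil =>
    intro D p
    rw [tsum_nil_only]
    · rw [ind_pos (q := ple S [] = []) (by simp [ple]), ind_pos (q := (fil S ([] : List U)).Nodup) (by simp [fil])]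
      simp [fil, FF]
    · intro l hl
      rw [ind_neg (q := ple S l = []) (by rwa [ple_nil_iff]), mul_zero]
  | cons b m ih =>
    intro D p
    rw [tsum_peel b]
    rotate_left
    · rw [ind_neg (q := ple S [] = b :: m) (by simp [ple]), mul_zero]
    · intro a l ha
      rw [ind_neg (ple_cons_ne S a b l m ha), mul_zero]
    simp only [ind_congr (dom_cons D b _), ind_and]
    by_cases hb : b ∈ D
    swap
    · simp [ind_neg hb]
    simp only [ind_pos hb, one_mul, List.cons_append, wt]
    by_cases hS : b ∈ S
    · have e : ∀ l, ind (ple S (b :: l) = b :: m) = ind (ple S (dropToLastOcc b l) = m) := by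
        intro l
        rw [ple, if_pos hS]; simp
      simp only [e]
      have e2 : ∀ l : List U, ind (dom D l) * (p b * wt P (P b) (l ++ [y])) *
          ind (ple S (dropToLastOcc b l) = m) = p b * (ind (dom D l) * wt P (P b) (l ++ [y]) *
          ind (ple S (dropToLastOcc b l) = m)) := by intro l; ring
      simp only [e2]
      rw [ENNReal.tsum_mul_left, loop_factor P D b y hb (fun l => ind (ple S l = m)), ih, fil_cons_mem m hS, FF]
      rw [← ind_congr (dom_erase D b m), ind_and, ind_congr (List.nodup_cons), ind_and,
        ind_congr (q := b ∉ fil S m) (r := b ∉ m) (by simp [mem_fil, hS])]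
      ring
    · have e : ∀ l, ind (ple S (b :: l) = b :: m) = ind (ple S l = m) := by
        intro l
        rw [ple, if_neg hS]; simp
      simp only [e]
      have e2 : ∀ l : List U, ind (dom D l) * (p b * wt P (P b) (l ++ [y])) *
          ind (ple S l = m) = p b * (ind (dom D l) * wt P (P b) (l ++ [y]) *
          ind (ple S l = m)) := by intro l; ring
      simp only [e2]
      rw [ENNReal.tsum_mul_left, ih, fil_cons_not m hS]
      ring

theorem tsum_fiber {U : Type*} (E : List U → List U) (f g : List U → ℝ≥0∞) :
    ∑' l : List U, f l * g (E l) = ∑' m : List U, (∑' l : List U, f l * ind (E l = m)) * g m := by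
  have h : ∀ l, f l * g (E l) = ∑' m : List U, f l * ind (E l = m) * g m := by
    intro l
    rw [tsum_eq_single (E l)]
    · rw [ind_pos rfl, mul_one]
    · intro m hm
      rw [ind_neg (Ne.symm hm)]; simp
  rw [tsum_congr h, ENNReal.tsum_comm]
  simp only [ENNReal.tsum_mul_right]

theorem ple_test {U : Type*} [DecidableEq U] (P : U → U → ℝ≥0∞) (S : Finset U) (y : U)
    (D : Finset U) (p : U → ℝ≥0∞) (g : List U → ℝ≥0∞) :
    ∑' l : List U, ind (dom D l) * wt P p (l ++ [y]) * g (ple S l) =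
      ∑' m : List U, ind (dom D m) * ind (fil S m).Nodup * wt P p (m ++ [y]) * FF P D (fil S m) * g m := by
  rw [tsum_fiber (ple S) (fun l => ind (dom D l) * wt P p (l ++ [y])) g]
  simp only [ple_mass]

theorem NN_eq {U : Type*} [DecidableEq U] (P : U → U → ℝ≥0∞) (S : Finset U) (y : U)
    (D : Finset U) (p : U → ℝ≥0∞) :
    NN P D p y = ∑' m : List U, ind (dom D m) * ind (fil S m).Nodup * wt P p (m ++ [y]) * FF P D (fil S m) := by
  have := ple_test P S y D p (fun _ => 1)
  simpa [NN] using this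

theorem inner_sum {U : Type*} [DecidableEq U] (P : U → U → ℝ≥0∞) (S : Finset U)
    (D : Finset U) (b : U) (hb : b ∈ D) (hS : b ∉ S) (k : List U) (hk : k.Nodup) (hkD : dom D k)
    (hkS : dom S k) :
    FF P D k + ∑' m : List U, ind (dom D m) * ind (fil S m ++ k).Nodup * wt P (P b) (m ++ [b]) *
      FF P D (fil S m ++ k) = GG P D b * FF P (D.erase b) k := by
  have hbk : b ∉ k := fun h => hS (hkS b h)
  have h1 : ∀ m : List U, ind (dom D m) * ind (fil S m ++ k).Nodup * wt P (P b) (m ++ [b]) *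
      FF P D (fil S m ++ k) = FF P D k * (ind (dom (D \ k.toFinset) m) * ind (fil S m).Nodup *
        wt P (P b) (m ++ [b]) * FF P (D \ k.toFinset) (fil S m)) := by
    intro m
    have hiff : (dom D m ∧ (fil S m ++ k).Nodup) ↔ (dom (D \ k.toFinset) m ∧ (fil S m).Nodup) := by
      rw [List.nodup_append]
      simp only [dom, Finset.mem_sdiff, List.mem_toFinset, mem_fil]
      simp only [dom] at hkS
      constructor
      · rintro ⟨h1, h2, -, h3⟩
        exact ⟨fun z hz => ⟨h1 z hz, fun hzk => h3 z ⟨hz, hkS z hzk⟩ z hzk rfl⟩, h2⟩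
      · rintro ⟨h1, h2⟩
        refine ⟨fun z hz => (h1 z hz).1, h2, hk, ?_⟩
        rintro z hz w hw rfl
        exact (h1 z hz.1).2 hw
    rw [← ind_and, ← ind_and, ← ind_congr hiff, mul_left_comm (FF P D k) , mul_assoc (ind _), mul_assoc (ind _)]
    refine ind_mul_congr fun h => ?_
    have hp := FF_perm P (List.perm_append_comm (l₁ := fil S m) (l₂ := k)) D h.2 (by
      intro z hz
      rcases List.mem_append.1 hz with hz | hz
      · exact h.1 z ((mem_fil S m z).1 hz).1
      · exact hkD z hz)
    rw [hp, FF_append]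
  simp only [h1]
  rw [ENNReal.tsum_mul_left, ← NN_eq]
  have h2 : GG P D b * FF P (D.erase b) k = FF P D ([b] ++ k) := rfl
  rw [h2, FF_perm P (List.perm_append_comm (l₁ := [b]) (l₂ := k)) D (by simp [hk, hbk]) (by
    intro z hz
    rcases List.mem_append.1 hz with hz | hz
    · rw [List.mem_singleton.1 hz]; exact hb
    · exact hkD z hz), FF_append]
  simp only [FF, GG]
  ring

theorem combine {U : Type*} [DecidableEq U] [Fintype U] (P : U → U → ℝ≥0∞) (S : Finset U) (y : U)
    (w : List U) : ∀ (D : Finset U) (p : U → ℝ≥0∞),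
    ∑' m : List U, ind (dom D m) * ind (fil S m).Nodup * wt P p (m ++ [y]) * FF P D (fil S m) *
        ind (ple Finset.univ m = w) =
      ind (dom D w) * ind w.Nodup * wt P p (w ++ [y]) * FF P D w := by
  induction w with
  | nil =>
    intro D p
    rw [tsum_nil_only]
    · rw [ind_pos (q := ple Finset.univ ([] : List U) = []) (by simp [ple])]
      simp [fil]
    · intro l hl
      rw [ind_neg (q := ple Finset.univ l = []) (by rwa [ple_nil_iff]), mul_zero]
  | cons b w ih =>
    intro D p
    rw [tsum_peel b]
    rotate_left
    · rw [ind_neg (q := ple Finset.univ [] = b :: w) (by simp [ple]), mul_zero]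
    · intro a l ha
      rw [ind_neg (ple_cons_ne Finset.univ a b l w ha), mul_zero]
    simp only [ind_congr (dom_cons D b _), ind_and]
    by_cases hb : b ∈ D
    swap
    · simp [ind_neg hb]
    simp only [ind_pos hb, one_mul, List.cons_append, wt]
    have e : ∀ l, ind (ple Finset.univ (b :: l) = b :: w) =
        ind (ple Finset.univ (dropToLastOcc b l) = w) := by
      intro l
      rw [ple, if_pos (Finset.mem_univ b)]; simp
    simp only [e]
    have key : ∑' l : List U, ind (dom D l) * ind (fil S (b :: l)).Nodup *
        (p b * wt P (P b) (l ++ [y])) * FF P D (fil S (b :: l)) *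
          ind (ple Finset.univ (dropToLastOcc b l) = w) = p b * (GG P D b *
        ∑' m : List U, ind (dom (D.erase b) m) * ind (fil S m).Nodup * wt P (P b) (m ++ [y]) *
          FF P (D.erase b) (fil S m) * ind (ple Finset.univ m = w)) := by
      by_cases hS : b ∈ S
      · rw [← ENNReal.tsum_mul_left, ← ENNReal.tsum_mul_left]
        refine tsum_congr fun l => ?_
        rw [fil_cons_mem l hS, FF, ← ind_congr (dom_erase D b l), ind_and, ind_congr (List.nodup_cons), ind_and,
          ind_congr (q := b ∉ fil S l) (r := b ∉ l) (by simp [mem_fil, hS])]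
        by_cases hl : b ∉ l
        · rw [aux_drop_not b l hl]; ring
        · rw [ind_neg hl]; simp
      · rw [tsum_last b, ← ENNReal.tsum_add, ← ENNReal.tsum_mul_left, ← ENNReal.tsum_mul_left]
        refine tsum_congr fun l => ?_
        by_cases hl : dom (D.erase b) l ∧ (fil S l).Nodup
        swap
        · have z1 : ind (dom (D.erase b) l) * ind (fil S l).Nodup = 0 := by
            rw [← ind_and, ind_neg hl]
          rw [z1]
          simp only [zero_mul, mul_zero, add_eq_zero, ENNReal.tsum_eq_zero]
          constructor
          · rw [fil_cons_not l hS]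
            rw [← ind_congr (dom_erase D b l), ind_and] at z1
            calc _ = (ind (b ∉ l) * ind (dom D l) * ind (fil S l).Nodup) *
                  ((p b * wt P (P b) (l ++ [y])) * FF P D (fil S l) *
                    ind (ple Finset.univ (dropToLastOcc b l) = w)) := by ring
              _ = 0 := by rw [z1, zero_mul]
          · intro m
            have z2 : ind (b ∉ l) * ind (dom D (m ++ b :: l)) *
                ind (fil S (b :: (m ++ b :: l))).Nodup = 0 := by
              rw [← ind_and, ← ind_and, ind_neg]
              rintro ⟨h1, h2⟩
              apply hl
              refine ⟨((dom_last D b hb m l).1 h1).2, ?_⟩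
              rw [fil_cons_not _ hS, fil_append, fil_cons_not _ hS] at h2
              exact (List.nodup_append.1 h2).2.1
            simp only [← mul_assoc]
            rw [z2]
            simp
        · obtain ⟨hl1, hl2⟩ := hl
          obtain ⟨hbl, hl3⟩ := (dom_erase D b l).2 hl1
          rw [ind_pos hbl, ind_pos hl1, ind_pos hl2, ind_pos hl3, aux_drop_not b l hbl,
            fil_cons_not l hS, ind_pos hl2]
          have hin := inner_sum P S D b hb hS (fil S l) hl2
            (fun z hz => hl3 z ((mem_fil S l z).1 hz).1) (fun z hz => ((mem_fil S l z).1 hz).2)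
          have e3 : ∀ m : List U, (1 : ℝ≥0∞) * (ind (dom D (m ++ b :: l)) *
              ind (fil S (b :: (m ++ b :: l))).Nodup * (p b * wt P (P b) (m ++ b :: l ++ [y])) *
              FF P D (fil S (b :: (m ++ b :: l))) *
              ind (ple Finset.univ (dropToLastOcc b (m ++ b :: l)) = w)) =
              (p b * wt P (P b) (l ++ [y]) * ind (ple Finset.univ l = w)) *
              (ind (dom D m) * ind (fil S m ++ fil S l).Nodup * wt P (P b) (m ++ [b]) *
                FF P D (fil S m ++ fil S l)) := by
            intro m
            have e4 : dom D (m ++ b :: l) ↔ dom D m := by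
              simp only [dom, List.mem_append, List.mem_cons] at hl3 ⊢
              grind
            rw [fil_cons_not _ hS, fil_append, fil_cons_not _ hS, aux_drop b m l hbl, wt_append',
              ind_congr e4]
            ring
          rw [tsum_congr e3, ENNReal.tsum_mul_left]
          calc _ = (p b * wt P (P b) (l ++ [y]) * ind (ple Finset.univ l = w)) *
              (FF P D (fil S l) + ∑' m : List U, ind (dom D m) * ind (fil S m ++ fil S l).Nodup *
                wt P (P b) (m ++ [b]) * FF P D (fil S m ++ fil S l)) := by ring
            _ = _ := by rw [hin]; ring
    rw [key, ih, FF, ← ind_congr (dom_erase D b w), ind_and, ind_congr (List.nodup_cons), ind_and]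
    ring

theorem fil_univ {U : Type*} [DecidableEq U] [Fintype U] (l : List U) : fil Finset.univ l = l := by
  simp [fil]

theorem law_eq {U : Type*} [DecidableEq U] [Fintype U] (P : U → U → ℝ≥0∞) (S : Finset U) (y : U)
    (D : Finset U) (p : U → ℝ≥0∞) (g : List U → ℝ≥0∞) :
    ∑' l : List U, ind (dom D l) * wt P p (l ++ [y]) * g (ple Finset.univ l) =
    ∑' l : List U, ind (dom D l) * wt P p (l ++ [y]) * g (ple Finset.univ (ple S l)) := by
  rw [ple_test P S y D p (fun m => g (ple Finset.univ m)), ple_test P Finset.univ y D p g,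
    tsum_fiber (ple Finset.univ)]
  simp only [combine, fil_univ]

theorem stopped_iff {U : Type*} [DecidableEq U] [Fintype U] (A : Finset U) (ω : ℕ → U) (l : List U) (y : U) :
    ((∃ n : ℕ, ω n ∈ A) ∧ stoppedPath A ω = l ++ [y]) ↔
      (dom Aᶜ l ∧ y ∈ A) ∧ ∀ i ≤ l.length, ω i = (l ++ [y]).getD i y := by
  unfold stoppedPath
  constructor
  · rintro ⟨hh, he⟩
    have hm : ω (entryTimeNat A ω) ∈ A := Nat.sInf_mem (s := {n : ℕ | ω n ∈ A}) hh
    have hlt : ∀ k < entryTimeNat A ω, ω k ∉ A := fun k hk =>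
      Nat.notMem_of_lt_sInf (s := {n : ℕ | ω n ∈ A}) hk
    have hlen : entryTimeNat A ω = l.length := by
      have := congrArg List.length he
      simpa using this
    have he' := he
    rw [List.range_succ, List.map_append, List.map_singleton] at he
    obtain ⟨h1, h2⟩ := List.append_inj' he rfl
    refine ⟨⟨?_, ?_⟩, ?_⟩
    · intro z hz
      rw [← h1] at hz
      simp only [List.mem_map, List.mem_range] at hz
      obtain ⟨k, hk, rfl⟩ := hz
      simpa using hlt k hk
    · simp at h2; rw [← h2]; exact hm
    · intro i hi
      rw [← he', List.getD_eq_getElem _ _ (by simp; omega)]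
      simp
  · rintro ⟨⟨h1, h2⟩, h3⟩
    have hy : ω l.length = y := by
      rw [h3 _ le_rfl]; simp
    have hl : ∀ i (hi : i < l.length), ω i = l[i] := by
      intro i hi
      rw [h3 i hi.le, List.getD_eq_getElem _ _ (by simp; omega), List.getElem_append_left hi]
    have hτ : entryTimeNat A ω = l.length := by
      apply le_antisymm
      · exact Nat.sInf_le (s := {n : ℕ | ω n ∈ A}) (by simpa [hy] using h2)
      · refine le_csInf ⟨l.length, by simpa [hy] using h2⟩ ?_
        intro k hk
        by_contra hlt
        push Not at hlt
        have : ω k ∈ A := hk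
        rw [hl k hlt] at this
        have := h1 _ (List.getElem_mem hlt)
        simp_all
    refine ⟨⟨_, hy.symm ▸ h2⟩, ?_⟩
    rw [hτ, List.range_succ, List.map_append, List.map_singleton, hy]
    congr 1
    apply List.ext_getElem
    · simp
    · intro i hi1 hi2
      simp [hl i hi2]

theorem wt_prod {U : Type*} (P : U → U → ℝ≥0∞) (b d : U) (l : List U) :
    wt P (P b) l = ∏ i ∈ Finset.Icc 1 l.length, P ((b :: l).getD (i - 1) d) ((b :: l).getD i d) := by
  have h : ∀ (n : ℕ) (g : ℕ → ℝ≥0∞), ∏ i ∈ Finset.Icc 1 n, g i = ∏ i ∈ Finset.range n, g (i + 1) := by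
    intro n g
    induction n with
    | zero => simp
    | succ n ih => rw [Finset.prod_Icc_succ_top (by omega), ih, Finset.prod_range_succ]
  rw [h]
  induction l generalizing b with
  | nil => simp [wt]
  | cons c l ih =>
    rw [List.length_cons, Finset.prod_range_succ', wt, ih c, mul_comm]
    simp

theorem cyl_meas {U : Type*} [MeasurableSpace U] [MeasurableSingletonClass U] (n : ℕ) (c : ℕ → U) :
    MeasurableSet {ω : ℕ → U | ∀ i ≤ n, ω i = c i} := by
  simp only [Set.ofPred_forall]
  refine MeasurableSet.iInter fun i => MeasurableSet.iInter fun _ => ?_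
  have : MeasurableSet ((fun ω : ℕ → U => ω i) ⁻¹' {c i}) :=
    measurable_pi_apply i (measurableSet_singleton (c i))
  exact this

theorem measure_formula {U : Type*} [Fintype U] [DecidableEq U]
    [MeasurableSpace U] [MeasurableSingletonClass U]
    (P : U → U → ℝ) (μ : Measure (ℕ → U)) (x : U)
    (hP0 : ∀ a b : U, 0 ≤ P a b)
    (hlaw : ∀ (n : ℕ) (y : ℕ → U),
      μ {ω | ∀ i ≤ n, ω i = y i} =
        ENNReal.ofReal ((if x = y 0 then (1 : ℝ) else 0) *
          ∏ i ∈ Finset.Icc 1 n, P (y (i - 1)) (y i)))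
    (A : Finset U) (Φ : List U → List U) (w : List U) :
    μ {ω | (∃ n : ℕ, ω n ∈ A) ∧ Φ (stoppedPath A ω) = w} =
      ∑' y : U, ind (y ∈ A) * ∑' l : List U, ind (dom Aᶜ l) *
        wt (fun a b => ENNReal.ofReal (P a b)) (fun b => ind (x = b)) (l ++ [y]) *
        ind (Φ (l ++ [y]) = w) := by
  classical
  let f : (ℕ → U) → List U := fun ω => if (∃ n : ℕ, ω n ∈ A) then stoppedPath A ω else []
  have hne : ∀ ω, stoppedPath A ω ≠ [] := by intro ω; simp [stoppedPath]
  have hf : ∀ l y, f ⁻¹' {l ++ [y]} = {ω | (dom Aᶜ l ∧ y ∈ A) ∧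
      ∀ i ≤ l.length, ω i = (l ++ [y]).getD i y} := by
    intro l y
    ext ω
    rw [Set.mem_ofPred_eq, ← stopped_iff]
    simp only [Set.mem_preimage, Set.mem_singleton_iff, f]
    split_ifs with h <;> simp [h]
  have hmeas : ∀ l y, MeasurableSet (f ⁻¹' {l ++ [y]}) := by
    intro l y
    rw [hf]
    by_cases h : dom Aᶜ l ∧ y ∈ A
    · simpa only [h, true_and, and_self] using cyl_meas l.length (fun i => (l ++ [y]).getD i y)
    · simp only [h, false_and, Set.ofPred_false, MeasurableSet.empty]
  have hmu : ∀ l y, μ (f ⁻¹' {l ++ [y]}) = ind (y ∈ A) * (ind (dom Aᶜ l) *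
      wt (fun a b => ENNReal.ofReal (P a b)) (fun b => ind (x = b)) (l ++ [y])) := by
    intro l y
    rw [hf]
    by_cases h : dom Aᶜ l ∧ y ∈ A
    · rw [ind_pos h.1, ind_pos h.2, one_mul, one_mul]
      simp only [h, true_and, and_self]
      rw [hlaw l.length (fun i => (l ++ [y]).getD i y)]
      obtain ⟨b, m, hbm⟩ : ∃ b m, l ++ [y] = b :: m := List.exists_cons_of_ne_nil (by simp)
      have hlen : l.length = m.length := by
        have := congrArg List.length hbm
        simpa using this
      rw [hbm, wt, wt_prod _ b y m, hlen, ENNReal.ofReal_mul (by split_ifs <;> simp),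
        ENNReal.ofReal_prod_of_nonneg (fun i _ => hP0 _ _)]
      congr 1
      simp only [List.getD_cons_zero, ind]
      split_ifs <;> simp
    · simp only [h, false_and, Set.ofPred_false, measure_empty]
      rw [← mul_assoc, ← ind_and, ind_neg (by tauto), zero_mul]
  have hset : {ω | (∃ n : ℕ, ω n ∈ A) ∧ Φ (stoppedPath A ω) = w} =
      f ⁻¹' {L | L ≠ [] ∧ Φ L = w} := by
    ext ω
    simp only [Set.mem_ofPred_eq, Set.mem_preimage, f]
    split_ifs with h
    · simp [h, hne]
    · simp [h]
  rw [hset, ← tsum_measure_preimage_singleton (Set.to_countable _)]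
  · rw [tsum_subtype {L | L ≠ [] ∧ Φ L = w} (fun L => μ (f ⁻¹' {L})), tsum_list_snoc]
    simp only [Set.indicator, Set.mem_ofPred_eq, ne_eq, not_true_eq_false, false_and, if_false, zero_add]
    refine tsum_congr fun y => ?_
    rw [← ENNReal.tsum_mul_left]
    refine tsum_congr fun l => ?_
    rw [hmu]
    by_cases h : Φ (l ++ [y]) = w
    · simp [h, ind_pos]
    · simp [h, ind_neg]
  · rintro L ⟨hL, -⟩
    rw [← List.dropLast_append_getLast hL]
    exact hmeas _ _

theorem PLE_comp {U : Type*} [Fintype U] [DecidableEq U] (S : Finset U) (y : U) (l : List U)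
    (h : y ∉ l) : LE (PLE S (l ++ [y])) = ple Finset.univ (ple S l) ++ [y] := by
  rw [PLE_snoc S y l h, LE, PLE_snoc _ _ _ (fun h' => h (ple_mem S l h'))]

end aux

theorem loop_erasure_eq_LE_after_partial_loop_erasure
    {V : Type*} [Fintype V] [DecidableEq V] [Nonempty V]
    [MeasurableSpace V] [MeasurableSingletonClass V]
    (P : V → V → ℝ) (μ : V → Measure (ℕ → V))
    (hP0 : ∀ a b : V, 0 ≤ P a b) (hP1 : ∀ a : V, ∑ b : V, P a b = 1)
    (hprob : ∀ a : V, IsProbabilityMeasure (μ a))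
    (hlaw : ∀ (a : V) (n : ℕ) (y : ℕ → V),
      μ a {ω | ∀ i ≤ n, ω i = y i} =
        ENNReal.ofReal ((if a = y 0 then (1 : ℝ) else 0) *
          ∏ i ∈ Finset.Icc 1 n, P (y (i - 1)) (y i)))
    (V₁ : Finset V) (hV₁ : V₁.Nonempty) (hV₁ne : V₁ ≠ Finset.univ)
    (A : Finset V) (x : V)
    (hx : μ x {ω | ∃ n : ℕ, ω n ∈ A} = 1) :
    ∀ w : List V,
      μ x {ω | (∃ n : ℕ, ω n ∈ A) ∧ LE (stoppedPath A ω) = w} =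
        μ x {ω | (∃ n : ℕ, ω n ∈ A) ∧ LE (PLE V₁ (stoppedPath A ω)) = w} := by
  intro w
  rw [measure_formula P (μ x) x hP0 (hlaw x) A LE w,
    measure_formula P (μ x) x hP0 (hlaw x) A (fun L => LE (PLE V₁ L)) w]
  refine tsum_congr fun y => ind_mul_congr fun hy => ?_
  have hnot : ∀ l, dom Aᶜ l → y ∉ l := by
    intro l hl hyl
    have := hl y hyl
    simp [hy] at this
  have h := law_eq (fun a b => ENNReal.ofReal (P a b)) V₁ y Aᶜ (fun b => ind (x = b))
    (fun L => ind (L ++ [y] = w))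
  refine Eq.trans (tsum_congr fun l => ?_) (h.trans (tsum_congr fun l => ?_))
  · simp only [mul_assoc]
    refine ind_mul_congr fun hl => ?_
    rw [LE, PLE_snoc _ _ _ (hnot l hl)]
  · simp only [mul_assoc]
    refine ind_mul_congr fun hl => ?_
    rw [PLE_comp _ _ _ (hnot l hl)]

end LERW
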